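/- For every positive integer n, the number of compositions (c_1,…,c_t) of n satisfying c_{2i-1} > c_{2i} for every index i with 2i ≤ t equals the n-th Fibonacci number f_n. -/

import Mathlib

/-- A composition of `n`: a list of positive integers summing to `n`. -/
def IsComposition (n : ℕ) (l : List ℕ) : Prop :=
  (∀ x ∈ l, 0 < x) ∧ l.sum = n

/-- Arndt condition: `c_{2i-1} > c_{2i}` for every pair of consecutive parts
(1-based odd index followed by even index), i.e. with 0-based indexing the part
at position `2i` exceeds the part at position `2i+1`. -/
def ArndtCond (l : List ℕ) : Prop :=
  ∀ i : ℕ, 2 * i + 1 < l.length → l.getD (2 * i + 1) 0 < l.getD (2 * i) 0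

theorem arndtCond_nil : ArndtCond [] := by
  intro i hi
  simp at hi

theorem arndtCond_singleton (a : ℕ) : ArndtCond [a] := by
  intro i hi
  simp at hi

theorem arndtCond_cons_cons {a b : ℕ} {l : List ℕ} :
    ArndtCond (a :: b :: l) ↔ b < a ∧ ArndtCond l := by
  constructor
  · intro h
    refine ⟨by simpa using h 0, fun i hi => ?_⟩
    have := h (i + 1) (by simp only [List.length_cons]; omega)
    simpa [show 2 * (i + 1) = 2 * i + 1 + 1 by ring] using this
  · rintro ⟨hab, h⟩ i hi
    cases i with
    | zero => simpa using hab
    | succ i =>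
      have := h i (by simp only [List.length_cons] at hi; omega)
      simpa [show 2 * (i + 1) = 2 * i + 1 + 1 by ring] using this

/-- The compositions of `n` satisfying the Arndt condition. -/
def arndtSet (n : ℕ) : Set (List ℕ) :=
  {l | IsComposition n l ∧ ArndtCond l}

theorem nil_mem_arndtSet {n : ℕ} : [] ∈ arndtSet n ↔ n = 0 := by
  simp [arndtSet, IsComposition, arndtCond_nil, eq_comm]

theorem singleton_mem_arndtSet {n a : ℕ} : [a] ∈ arndtSet n ↔ 0 < a ∧ a = n := by
  simp [arndtSet, IsComposition, arndtCond_singleton]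

theorem cons_cons_mem_arndtSet {n a b : ℕ} {l : List ℕ} :
    a :: b :: l ∈ arndtSet n ↔ 0 < b ∧ b < a ∧ ∃ m, n = a + b + m ∧ l ∈ arndtSet m := by
  simp only [arndtSet, IsComposition, Set.mem_ofPred_eq, arndtCond_cons_cons,
    List.forall_mem_cons, List.sum_cons]
  constructor
  · rintro ⟨⟨⟨_, hb, hl⟩, hn⟩, hab, h⟩
    exact ⟨hb, hab, l.sum, by omega, ⟨hl, rfl⟩, h⟩
  · rintro ⟨hb, hab, m, hn, ⟨hl, hm⟩, h⟩
    exact ⟨⟨⟨by omega, hb, hl⟩, by omega⟩, hab, h⟩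

/-- Increase the first part by one, the empty list being sent to `[1]`. -/
def incrHead : List ℕ → List ℕ
  | [] => [1]
  | a :: l => (a + 1) :: l

/-- Increase the first two parts by one. -/
def incrHeadPair : List ℕ → List ℕ
  | a :: b :: l => (a + 1) :: (b + 1) :: l
  | l => l

/-- The Arndt compositions of `n` whose first two parts differ by exactly one. -/
def tightArndtSet (n : ℕ) : Set (List ℕ) :=
  {l ∈ arndtSet n | ∃ b t, l = (b + 1) :: b :: t}

theorem arndtSet_succ (n : ℕ) :
    arndtSet (n + 1) = incrHead '' arndtSet n ∪ tightArndtSet (n + 1) := by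
  ext l
  constructor
  · intro h
    match l, h with
    | [], h => simp [nil_mem_arndtSet] at h
    | [a], h =>
      obtain ⟨_, rfl⟩ := singleton_mem_arndtSet.1 h
      left
      rcases Nat.eq_zero_or_pos n with rfl | hn
      · exact ⟨[], nil_mem_arndtSet.2 rfl, rfl⟩
      · exact ⟨[n], singleton_mem_arndtSet.2 ⟨hn, rfl⟩, rfl⟩
    | a :: b :: t, h =>
      obtain ⟨hb, hab, m, hm, ht⟩ := cons_cons_mem_arndtSet.1 h
      rcases eq_or_ne a (b + 1) with rfl | hne
      · exact Or.inr ⟨h, b, t, rfl⟩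
      · obtain ⟨c, rfl⟩ : ∃ c, a = c + 1 := ⟨a - 1, by omega⟩
        exact Or.inl ⟨c :: b :: t,
          cons_cons_mem_arndtSet.2 ⟨hb, by omega, m, by omega, ht⟩, rfl⟩
  · rintro (⟨s, hs, rfl⟩ | h)
    · match s, hs with
      | [], hs =>
        obtain rfl := nil_mem_arndtSet.1 hs
        exact singleton_mem_arndtSet.2 ⟨one_pos, rfl⟩
      | [a], hs =>
        obtain ⟨_, rfl⟩ := singleton_mem_arndtSet.1 hs
        exact singleton_mem_arndtSet.2 ⟨a.succ_pos, rfl⟩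
      | a :: b :: t, hs =>
        obtain ⟨hb, hab, m, hm, ht⟩ := cons_cons_mem_arndtSet.1 hs
        exact cons_cons_mem_arndtSet.2 ⟨hb, by omega, m, by omega, ht⟩
    · exact h.1

theorem disjoint_incrHead_image_tightArndtSet (n m : ℕ) :
    Disjoint (incrHead '' arndtSet n) (tightArndtSet m) := by
  rw [Set.disjoint_left]
  rintro _ ⟨s, hs, rfl⟩ ⟨_, b, t, h⟩
  match s, hs, h with
  | a :: l, hs, h =>
    simp only [incrHead, List.cons.injEq, Nat.add_right_cancel_iff] at h
    obtain ⟨rfl, rfl⟩ := h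
    exact (cons_cons_mem_arndtSet.1 hs).2.1.ne rfl

theorem injOn_incrHead (n : ℕ) : Set.InjOn incrHead (arndtSet n) := by
  intro s hs t ht h
  have hs' := hs.1.1
  have ht' := ht.1.1
  cases s <;> cases t <;> simp_all [incrHead]

theorem encard_arndtSet_succ (n : ℕ) :
    (arndtSet (n + 1)).encard = (arndtSet n).encard + (tightArndtSet (n + 1)).encard := by
  rw [arndtSet_succ, Set.encard_union_eq (disjoint_incrHead_image_tightArndtSet _ _),
    (injOn_incrHead n).encard_image]

theorem tightArndtSet_add_three (n : ℕ) :
    tightArndtSet (n + 3) =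
      (fun l => 2 :: 1 :: l) '' arndtSet n ∪ incrHeadPair '' tightArndtSet (n + 1) := by
  ext l
  constructor
  · rintro ⟨h, b, t, rfl⟩
    obtain ⟨hb, -, m, hm, ht⟩ := cons_cons_mem_arndtSet.1 h
    obtain ⟨c, rfl⟩ : ∃ c, b = c + 1 := ⟨b - 1, by omega⟩
    rcases Nat.eq_zero_or_pos c with rfl | hc
    · obtain rfl : m = n := by omega
      exact Or.inl ⟨t, ht, rfl⟩
    · exact Or.inr ⟨(c + 1) :: c :: t, ⟨cons_cons_mem_arndtSet.2
        ⟨hc, by omega, m, by omega, ht⟩, c, t, rfl⟩, rfl⟩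
  · rintro (⟨t, ht, rfl⟩ | ⟨_, ⟨h, b, t, rfl⟩, rfl⟩)
    · exact ⟨cons_cons_mem_arndtSet.2 ⟨by omega, by omega, n, by omega, ht⟩, 1, t, rfl⟩
    · obtain ⟨hb, -, m, hm, ht⟩ := cons_cons_mem_arndtSet.1 h
      exact ⟨cons_cons_mem_arndtSet.2 ⟨by omega, by omega, m, by omega, ht⟩, b + 1, t, rfl⟩

theorem encard_tightArndtSet_add_three (n : ℕ) :
    (tightArndtSet (n + 3)).encard = (arndtSet (n + 1)).encard := by
  rw [tightArndtSet_add_three, Set.encard_union_eq, Set.InjOn.encard_image,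
    Set.InjOn.encard_image, encard_arndtSet_succ]
  · rintro _ ⟨-, b, s, rfl⟩ _ ⟨-, c, t, rfl⟩ h
    simpa [incrHeadPair] using h
  · intro s _ t _ h
    simpa using h
  · rw [Set.disjoint_left]
    rintro _ ⟨t, -, rfl⟩ ⟨_, ⟨h, b, s, rfl⟩, heq⟩
    have hb := (cons_cons_mem_arndtSet.1 h).1
    simp only [incrHeadPair, List.cons.injEq] at heq
    omega

theorem tightArndtSet_eq_empty {n : ℕ} (hn : n < 3) : tightArndtSet n = ∅ := by
  rw [Set.eq_empty_iff_forall_notMem]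
  rintro _ ⟨h, b, t, rfl⟩
  obtain ⟨hb, -, m, hm, -⟩ := cons_cons_mem_arndtSet.1 h
  omega

theorem encard_arndtSet_zero : (arndtSet 0).encard = 1 := by
  rw [Set.encard_eq_one]
  refine ⟨[], Set.eq_singleton_iff_unique_mem.2 ⟨nil_mem_arndtSet.2 rfl, fun l hl => ?_⟩⟩
  match l, hl with
  | [], _ => rfl
  | a :: l, hl =>
    have ha := hl.1.1 a (by simp)
    have hsum := hl.1.2
    simp only [List.sum_cons] at hsum
    omega

theorem encard_arndtSet_succ_eq_fib (n : ℕ) :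
    (arndtSet (n + 1)).encard = Nat.fib (n + 1) := by
  induction n using Nat.twoStepInduction with
  | zero =>
    simp [encard_arndtSet_succ, encard_arndtSet_zero, tightArndtSet_eq_empty]
  | one =>
    simp [encard_arndtSet_succ, encard_arndtSet_zero, tightArndtSet_eq_empty]
  | more n ih₁ ih₂ =>
    rw [encard_arndtSet_succ, encard_tightArndtSet_add_three, ih₁, ih₂,
      Nat.fib_add_two (n := n + 1), Nat.cast_add, add_comm]

theorem arndt_count_eq_fib (n : ℕ) (hn : 0 < n) :
    Nat.card {l : List ℕ // IsComposition n l ∧ ArndtCond l} = Nat.fib n := by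
  obtain ⟨m, rfl⟩ := Nat.exists_eq_add_one.2 hn
  change (arndtSet (m + 1)).ncard = _
  rw [Set.ncard, encard_arndtSet_succ_eq_fib, ENat.toNat_natCast]
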